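/- Let Γ be a finite simple graph and let H be a subgroup of the right-angled Coxeter group C(Γ) generated by finitely many reflections. Then H is a virtual retract of C(Γ): there exists a finite-index subgroup K of C(Γ) containing H and a group homomorphism r : K → H such that r(h) = h for every h ∈ H. -/

import Mathlib

/-- The defining relations of the right-angled Coxeter group of a simple graph:
squares of the generators, and squares of products of generators corresponding to
adjacent vertices. -/
def racgRels {V : Type*} (G : SimpleGraph V) : Set (FreeGroup V) :=
  {r | (∃ v : V, r = FreeGroup.of v * FreeGroup.of v) ∨
    ∃ u v : V, G.Adj u v ∧ r = (FreeGroup.of u * FreeGroup.of v) ^ 2}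

/-- The right-angled Coxeter group of a simple graph. -/
abbrev RACG {V : Type*} (G : SimpleGraph V) : Type _ := PresentedGroup (racgRels G)

/-- The canonical generator of the right-angled Coxeter group corresponding to a vertex. -/
def racgGen {V : Type*} (G : SimpleGraph V) (v : V) : RACG G := PresentedGroup.of v

/-- A reflection of a right-angled Coxeter group: a conjugate of a canonical generator. -/
def IsReflection {V : Type*} (G : SimpleGraph V) (x : RACG G) : Prop :=
  ∃ (g : RACG G) (v : V), x = g * racgGen G v * g⁻¹

/-- Word length on a right-angled Coxeter group with respect to the canonical generators
(the generators are involutions, so words in the generators suffice). -/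
noncomputable def racgLen {V : Type*} (G : SimpleGraph V) (x : RACG G) : ℕ :=
  sInf {n | ∃ l : List V, l.length = n ∧ (l.map (racgGen G)).prod = x}

namespace RACG

variable {V : Type*} {Γ : SimpleGraph V}

lemma racgGen_mul_self (v : V) : racgGen Γ v * racgGen Γ v = 1 :=
  PresentedGroup.one_of_mem (rels := racgRels Γ) (Or.inl ⟨v, rfl⟩)

lemma racgGen_inv (v : V) : (racgGen Γ v)⁻¹ = racgGen Γ v :=
  inv_eq_of_mul_eq_one_left (racgGen_mul_self v)

lemma racgGen_comm {u v : V} (h : Γ.Adj u v) :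
    racgGen Γ u * racgGen Γ v = racgGen Γ v * racgGen Γ u := by
  have key : (racgGen Γ u * racgGen Γ v) ^ 2 = 1 :=
    PresentedGroup.one_of_mem (rels := racgRels Γ) (Or.inr ⟨u, v, h, rfl⟩)
  rw [pow_two] at key
  have := eq_inv_of_mul_eq_one_left key
  rwa [mul_inv_rev, racgGen_inv, racgGen_inv] at this

/-- The universal property of a right-angled Coxeter group. -/
lemma exists_lift {G : Type*} [Group G] (f : V → G) (hf : ∀ v, f v * f v = 1)
    (hc : ∀ u v, Γ.Adj u v → f u * f v = f v * f u) :
    ∃ φ : RACG Γ →* G, ∀ v, φ (racgGen Γ v) = f v := by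
  have hr : ∀ r ∈ racgRels Γ, FreeGroup.lift f r = 1 := by
    rintro r (⟨v, rfl⟩ | ⟨u, v, h, rfl⟩)
    · simp [hf]
    · simp only [map_mul, FreeGroup.lift_apply_of, pow_two]
      rw [mul_assoc, hc u v h, ← mul_assoc (f v), hf, one_mul, hf]
  exact ⟨PresentedGroup.toGroup hr, fun v => PresentedGroup.toGroup.of hr⟩

/-- The element of the right-angled Coxeter group spelled by a word. -/
def wordProd (Γ : SimpleGraph V) (l : List V) : RACG Γ := (l.map (racgGen Γ)).prod

lemma wordProd_append (a b : List V) :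
    wordProd Γ (a ++ b) = wordProd Γ a * wordProd Γ b := by
  simp [wordProd]

lemma wordProd_cons (v : V) (b : List V) :
    wordProd Γ (v :: b) = racgGen Γ v * wordProd Γ b := by
  simp [wordProd]

lemma wordProd_concat (a : List V) (v : V) :
    wordProd Γ (a ++ [v]) = wordProd Γ a * racgGen Γ v := by
  simp [wordProd]

lemma wordProd_surjective : Function.Surjective (wordProd Γ) := by
  intro g
  have hg : g ∈ Subgroup.closure (Set.range (racgGen Γ)) := by
    have h : Subgroup.closure (Set.range (racgGen Γ)) = ⊤ :=
      PresentedGroup.closure_range_of (racgRels Γ)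
    simp [h]
  induction hg using Subgroup.closure_induction with
  | mem x hx =>
    obtain ⟨v, rfl⟩ := hx
    exact ⟨[v], by simp [wordProd]⟩
  | one => exact ⟨[], rfl⟩
  | mul x y _ _ hx hy =>
    obtain ⟨a, rfl⟩ := hx
    obtain ⟨b, rfl⟩ := hy
    exact ⟨a ++ b, wordProd_append a b⟩
  | inv x _ hx =>
    obtain ⟨a, rfl⟩ := hx
    refine ⟨a.reverse, ?_⟩
    simp [wordProd, List.prod_inv_reverse, Function.comp_def, racgGen_inv]

/-- The reflection crossed when moving from `g` to `g * v`. -/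
def wall (g : RACG Γ) (v : V) : RACG Γ := g * racgGen Γ v * g⁻¹

lemma wall_mul_self (g : RACG Γ) (v : V) : wall g v * wall g v = 1 := by
  have := racgGen_mul_self (Γ := Γ) v
  simp only [wall]
  calc _ = g * (racgGen Γ v * racgGen Γ v) * g⁻¹ := by group
    _ = 1 := by rw [this]; group

lemma wall_mul_gen (g : RACG Γ) {u v : V}
    (h : racgGen Γ u * racgGen Γ v = racgGen Γ v * racgGen Γ u) :
    wall (g * racgGen Γ u) v = wall g v := by
  simp only [wall, mul_inv_rev]
  rw [mul_assoc g, h]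
  group

lemma wall_comm (g : RACG Γ) {u v : V}
    (h : racgGen Γ u * racgGen Γ v = racgGen Γ v * racgGen Γ u) :
    wall g u * wall g v = wall g v * wall g u := by
  have aux : ∀ a b : V, wall g a * wall g b = g * (racgGen Γ a * racgGen Γ b) * g⁻¹ := by
    intro a b
    simp only [wall]
    group
  rw [aux, aux, h]

lemma wall_mul (g h : RACG Γ) (v : V) : wall (g * h) v = g * wall h v * g⁻¹ := by
  simp only [wall]
  group

open Classical in
/-- There is a `ZMod 2`-valued cocycle `n` recording the parity of the number of times that a
path from `1` to `g` crosses a given wall. -/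
lemma exists_parity (Γ : SimpleGraph V) :
    ∃ n : RACG Γ → RACG Γ → ZMod 2, (∀ x, n 1 x = 0) ∧
      ∀ g v x, n (g * racgGen Γ v) x = n g x + if x = wall g v then 1 else 0 := by
  let step : V → (RACG Γ → ZMod 2) → (RACG Γ → ZMod 2) := fun v A x =>
    A (racgGen Γ v * x * racgGen Γ v) + if x = racgGen Γ v then 1 else 0
  have conj_eq : ∀ u v, racgGen Γ u * racgGen Γ v = racgGen Γ v * racgGen Γ u → ∀ x,
      racgGen Γ u * x * racgGen Γ u = racgGen Γ v ↔ x = racgGen Γ v := by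
    intro u v h x
    rw [← eq_mul_inv_iff_mul_eq, racgGen_inv, ← h, mul_right_inj]
  have step_step : ∀ v A, step v (step v A) = A := by
    intro v A
    funext x
    have h1 : racgGen Γ v * (racgGen Γ v * x * racgGen Γ v) * racgGen Γ v = x := by
      calc _ = (racgGen Γ v * racgGen Γ v) * x * (racgGen Γ v * racgGen Γ v) := by group
        _ = x := by rw [racgGen_mul_self]; group
    simp only [step, h1, conj_eq v v rfl, add_assoc, CharTwo.add_self_eq_zero, add_zero]
  let f : V → Equiv.Perm (RACG Γ → ZMod 2) := fun v =>
    ⟨step v, step v, step_step v, step_step v⟩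
  obtain ⟨φ, hφ⟩ := exists_lift (Γ := Γ) f (fun v => Equiv.ext (step_step v)) (by
    intro u v h
    have hc := racgGen_comm h
    ext A x
    have h1 : racgGen Γ u * (racgGen Γ v * x * racgGen Γ v) * racgGen Γ u =
        racgGen Γ v * (racgGen Γ u * x * racgGen Γ u) * racgGen Γ v := by
      calc _ = (racgGen Γ u * racgGen Γ v) * x * (racgGen Γ v * racgGen Γ u) := by group
        _ = (racgGen Γ v * racgGen Γ u) * x * (racgGen Γ u * racgGen Γ v) := by rw [hc]
        _ = _ := by group
    simp only [f, step, Equiv.Perm.mul_apply, Equiv.coe_fn_mk, conj_eq u v hc,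
      conj_eq v u hc.symm, h1]
    ring)
  have hφ' : ∀ v A x, φ (racgGen Γ v) A x =
      A (racgGen Γ v * x * racgGen Γ v) + if x = racgGen Γ v then 1 else 0 := by
    intro v A x
    rw [hφ]
    rfl
  have twist : ∀ l A x,
      φ (wordProd Γ l) A x = A ((wordProd Γ l)⁻¹ * x * wordProd Γ l) + φ (wordProd Γ l) 0 x := by
    intro l
    induction l with
    | nil => simp [wordProd]
    | cons v l ih =>
      intro A x
      rw [wordProd_cons, map_mul, Equiv.Perm.mul_apply, Equiv.Perm.mul_apply, hφ', hφ', ih A,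
        mul_inv_rev, racgGen_inv]
      simp only [mul_assoc, add_assoc]
  refine ⟨fun g x => φ g 0 x, by simp, fun g v x => ?_⟩
  obtain ⟨l, rfl⟩ := wordProd_surjective g
  have h2 : (wordProd Γ l)⁻¹ * x * wordProd Γ l = racgGen Γ v ↔ x = wall (wordProd Γ l) v := by
    rw [wall, mul_assoc, inv_mul_eq_iff_eq_mul, eq_mul_inv_iff_mul_eq]
  simp only [map_mul, Equiv.Perm.mul_apply]
  rw [twist, hφ']
  simp only [Pi.zero_apply, zero_add, h2, add_comm]

/-- The parity cocycle of the walls separating `1` from an element. -/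
noncomputable def parity (Γ : SimpleGraph V) : RACG Γ → RACG Γ → ZMod 2 :=
  (exists_parity Γ).choose

lemma parity_one (x : RACG Γ) : parity Γ 1 x = 0 := (exists_parity Γ).choose_spec.1 x

lemma parity_mul_gen_of_ne {g x : RACG Γ} {v : V} (h : x ≠ wall g v) :
    parity Γ (g * racgGen Γ v) x = parity Γ g x := by
  have := (exists_parity Γ).choose_spec.2 g v x
  rwa [if_neg h, add_zero] at this

lemma parity_mul_gen_wall (g : RACG Γ) (v : V) :
    parity Γ (g * racgGen Γ v) (wall g v) = parity Γ g (wall g v) + 1 := by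
  have := (exists_parity Γ).choose_spec.2 g v (wall g v)
  rwa [if_pos rfl] at this

/-- The set of reflections whose walls separate `1` from `g`. -/
def inversions (g : RACG Γ) : Set (RACG Γ) := {x | parity Γ g x ≠ 0}

lemma inversions_one : inversions (1 : RACG Γ) = ∅ := by
  ext x
  simp [inversions, parity_one]

lemma mem_inversions_mul_gen_of_ne {g x : RACG Γ} {v : V} (h : x ≠ wall g v) :
    x ∈ inversions (g * racgGen Γ v) ↔ x ∈ inversions g := by
  simp only [inversions, Set.mem_ofPred_eq, parity_mul_gen_of_ne h]

lemma wall_mem_inversions_mul_gen (g : RACG Γ) (v : V) :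
    wall g v ∈ inversions (g * racgGen Γ v) ↔ wall g v ∉ inversions g := by
  simp only [inversions, Set.mem_ofPred_eq, parity_mul_gen_wall]
  generalize parity Γ g (wall g v) = a
  revert a
  decide

lemma exists_of_mem_inversions {x : RACG Γ} {l : List V} (h : x ∈ inversions (wordProd Γ l)) :
    ∃ a v b, l = a ++ v :: b ∧ x = wall (wordProd Γ a) v := by
  induction l using List.reverseRecOn with
  | nil => simp [wordProd, inversions_one] at h
  | append_singleton l v ih =>
    by_cases hx : x = wall (wordProd Γ l) v
    · exact ⟨l, v, [], rfl, hx⟩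
    · rw [wordProd_concat, mem_inversions_mul_gen_of_ne hx] at h
      obtain ⟨a, u, b, rfl, rfl⟩ := ih h
      exact ⟨a, u, b ++ [v], by simp, rfl⟩

lemma wall_mul_wordProd (a b : List V) (v : V) :
    wall (wordProd Γ a) v * wordProd Γ (a ++ v :: b) = wordProd Γ (a ++ b) := by
  rw [wordProd_append, wordProd_append, wordProd_cons, wall]
  calc _ = wordProd Γ a * (racgGen Γ v * racgGen Γ v) * wordProd Γ b := by group
    _ = _ := by rw [racgGen_mul_self, mul_one]

/-- A word is geodesic if the path it spells never crosses a wall twice. -/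
def IsGeodesic (Γ : SimpleGraph V) (l : List V) : Prop :=
  ∀ a v b, l = a ++ v :: b → wall (wordProd Γ a) v ∉ inversions (wordProd Γ a)

lemma exists_isGeodesic (g : RACG Γ) : ∃ l, IsGeodesic Γ l ∧ wordProd Γ l = g := by
  obtain ⟨l, hl, hmin⟩ := exists_minimalFor_of_wellFoundedLT (fun l => wordProd Γ l = g)
    List.length (wordProd_surjective g)
  refine ⟨l, ?_, hl⟩
  rintro a v b rfl hmem
  obtain ⟨c, u, d, rfl, hw⟩ := exists_of_mem_inversions hmem
  have h1 : wordProd Γ (c ++ d ++ b) = g := by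
    rw [← hl, wordProd_append _ b, ← wall_mul_wordProd c d u, ← hw, wall,
      wordProd_append _ (v :: b), wordProd_cons]
    group
  have h2 := hmin h1
  simp at h2
  lia

lemma IsGeodesic.of_concat {l : List V} {v : V} (h : IsGeodesic Γ (l ++ [v])) :
    IsGeodesic Γ l := by
  rintro a u b rfl
  exact h a u (b ++ [v]) (by simp)

lemma IsGeodesic.inversions_concat {l : List V} {v : V} (h : IsGeodesic Γ (l ++ [v])) :
    inversions (wordProd Γ (l ++ [v])) =
      insert (wall (wordProd Γ l) v) (inversions (wordProd Γ l)) := by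
  ext x
  rw [wordProd_concat]
  by_cases hx : x = wall (wordProd Γ l) v
  · subst hx
    simpa [wall_mem_inversions_mul_gen] using h l v [] rfl
  · simp [mem_inversions_mul_gen_of_ne hx, hx]

lemma IsGeodesic.encard_inversions {l : List V} (h : IsGeodesic Γ l) :
    (inversions (wordProd Γ l)).encard = l.length := by
  induction l using List.reverseRecOn with
  | nil => simp [wordProd, inversions_one]
  | append_singleton l v ih =>
    rw [h.inversions_concat, Set.encard_insert_of_notMem (h l v [] rfl), ih h.of_concat]
    simp

lemma inversions_finite (g : RACG Γ) : (inversions g).Finite := by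
  obtain ⟨l, hl, rfl⟩ := exists_isGeodesic g
  exact Set.finite_of_encard_eq_coe hl.encard_inversions

/-- The elements separated from `1` only by walls in `P`. -/
def cell (P : Set (RACG Γ)) : Set (RACG Γ) := {g | inversions g ⊆ P}

lemma one_mem_cell (P : Set (RACG Γ)) : 1 ∈ cell P := by
  simp [cell, inversions_one]

lemma cell_finite [Finite V] {P : Set (RACG Γ)} (hP : P.Finite) : (cell P).Finite := by
  refine ((List.finite_length_le V P.ncard).image (wordProd Γ)).subset fun g hg => ?_
  obtain ⟨l, hl, rfl⟩ := exists_isGeodesic g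
  refine ⟨l, ?_, rfl⟩
  have h1 := Set.encard_le_encard (show inversions (wordProd Γ l) ⊆ P from hg)
  rw [hl.encard_inversions, ← hP.cast_ncard_eq] at h1
  exact_mod_cast h1

lemma wall_mem_of_mem_cell {P : Set (RACG Γ)} {g : RACG Γ} {v : V} (hg : g ∈ cell P)
    (hgv : g * racgGen Γ v ∈ cell P) : wall g v ∈ P := by
  by_cases h : wall g v ∈ inversions g
  · exact hg h
  · exact hgv ((wall_mem_inversions_mul_gen g v).2 h)

lemma mul_gen_mem_cell {P : Set (RACG Γ)} {g : RACG Γ} {v : V} (hg : g ∈ cell P)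
    (hw : wall g v ∈ P) : g * racgGen Γ v ∈ cell P := by
  intro x hx
  by_cases h : x = wall g v
  · exact h ▸ hw
  · exact hg ((mem_inversions_mul_gen_of_ne h).1 hx)

lemma mul_gen_mem_cell_iff {P : Set (RACG Γ)} {g : RACG Γ} {v : V} (hg : g ∈ cell P) :
    g * racgGen Γ v ∈ cell P ↔ wall g v ∈ P :=
  ⟨wall_mem_of_mem_cell hg, mul_gen_mem_cell hg⟩

/-- A reflection in `H` lies in the subgroup generated by those reflections in `H` whose walls
bound the chamber of `H` containing `1`. -/
lemma wall_mem_closure (H : Subgroup (RACG Γ)) (l : List V) (v : V)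
    (hv : wall (wordProd Γ l) v ∈ H) :
    wall (wordProd Γ l) v ∈ Subgroup.closure
      {t | t ∈ H ∧ ∃ f u, t = wall f u ∧ Disjoint (inversions f) (H : Set (RACG Γ))} := by
  induction hn : l.length using Nat.strong_induction_on generalizing l v with
  | _ n ih =>
    by_cases hd : Disjoint (inversions (wordProd Γ l)) (H : Set (RACG Γ))
    · exact Subgroup.subset_closure ⟨hv, _, _, rfl, hd⟩
    · obtain ⟨x, hx, hxH⟩ := Set.not_disjoint_iff.1 hd
      obtain ⟨a, u, b, rfl, rfl⟩ := exists_of_mem_inversions hx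
      simp only [List.length_append, List.length_cons] at hn
      have hx' := ih a.length (by lia) a u hxH rfl
      have key : wall (wordProd Γ (a ++ b)) v =
          wall (wordProd Γ a) u * wall (wordProd Γ (a ++ u :: b)) v * (wall (wordProd Γ a) u)⁻¹ := by
        rw [← wall_mul_wordProd, wall_mul]
      have h2 := ih (a ++ b).length (by simp; lia) (a ++ b) v
        (key ▸ H.mul_mem (H.mul_mem hxH hv) (H.inv_mem hxH)) rfl
      rw [key] at h2
      exact (Subgroup.mul_mem_cancel_left _ hx').1
        ((Subgroup.mul_mem_cancel_right _ (inv_mem hx')).1 h2)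

end RACG

/-- If `s` is finite and contained in the subgroup generated by `R`, then it is contained in the
subgroup generated by a finite subset of `R`. -/
lemma Subgroup.exists_finite_subset_closure {G : Type*} [Group G] {R s : Set G} (hs : s.Finite)
    (h : s ⊆ Subgroup.closure R) :
    ∃ T ⊆ R, T.Finite ∧ s ⊆ Subgroup.closure T := by
  have single : ∀ x ∈ Subgroup.closure R, ∃ T ⊆ R, T.Finite ∧ x ∈ Subgroup.closure T := by
    intro x hx
    induction hx using Subgroup.closure_induction with
    | mem x hx => exact ⟨{x}, by simpa using hx, by simp, Subgroup.subset_closure rfl⟩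
    | one => exact ⟨∅, by simp, by simp, one_mem _⟩
    | mul x y _ _ hx hy =>
      obtain ⟨T, hT, hTf, hxT⟩ := hx
      obtain ⟨U, hU, hUf, hyU⟩ := hy
      exact ⟨T ∪ U, Set.union_subset hT hU, hTf.union hUf,
        mul_mem (Subgroup.closure_mono Set.subset_union_left hxT)
          (Subgroup.closure_mono Set.subset_union_right hyU)⟩
    | inv x _ hx =>
      obtain ⟨T, hT, hTf, hxT⟩ := hx
      exact ⟨T, hT, hTf, inv_mem hxT⟩
  choose! T hT hTf hxT using single
  exact ⟨⋃ x ∈ s, T x, Set.iUnion₂_subset fun x hx => hT x (h hx),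
    hs.biUnion fun x hx => hTf x (h hx), fun x hx =>
      Subgroup.closure_mono (Set.subset_biUnion_of_mem hx) (hxT x (h hx))⟩

/-- A subgroup `H` is a virtual retract as soon as the ambient group acts on `H × F`, with `F`
finite, commuting with left translations by `H`, in such a way that generators of `H` act on some
`(1, o)` as left translations by their inverses. -/
lemma Subgroup.virtual_retract_of_perm {G F : Type*} [Group G] [Finite F] (H : Subgroup G)
    (ψ : G →* Equiv.Perm (H × F))
    (hψ : ∀ g a p, ψ g (a * p.1, p.2) = (a * (ψ g p).1, (ψ g p).2))
    (o : F) (R : Set G) (hR : Subgroup.closure R = H)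
    (ho : ∀ (x : G) (hx : x ∈ H), x ∈ R → ψ x (1, o) = (⟨x, hx⟩⁻¹, o)) :
    ∃ K : Subgroup G, ∃ hK : H ≤ K, K.FiniteIndex ∧
      ∃ r : K →* H, ∀ (h : G) (hh : h ∈ H), (r ⟨h, hK hh⟩ : G) = h := by
  have hψ1 : ∀ g a f, ψ g (a, f) = (a * (ψ g (1, f)).1, (ψ g (1, f)).2) := by
    intro g a f
    simpa using hψ g a (1, f)
  let : MulAction G F :=
    { smul := fun g f => (ψ g (1, f)).2
      one_smul := fun f => by
        change (ψ 1 (1, f)).2 = f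
        simp
      mul_smul := fun g h f => by
        change (ψ (g * h) (1, f)).2 = (ψ g (1, (ψ h (1, f)).2)).2
        rw [map_mul, Equiv.Perm.mul_apply, ← Prod.mk.eta (p := ψ h (1, f)), hψ1] }
  have smul_def : ∀ (g : G) (f : F), g • f = (ψ g (1, f)).2 := fun _ _ => rfl
  have hH : ∀ (x : G) (hx : x ∈ H), ψ x (1, o) = (⟨x, hx⟩⁻¹, o) := by
    intro x hx
    have hx' : x ∈ Subgroup.closure R := hR ▸ hx
    induction hx' using Subgroup.closure_induction with
    | mem x hxR => exact ho x hx hxR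
    | one => simp
    | mul x y hx1 hy1 ihx ihy =>
      rw [hR] at hx1 hy1
      rw [map_mul, Equiv.Perm.mul_apply, ihy hy1, hψ1, ihx hx1, ← mul_inv_rev]
      rfl
    | inv x hx1 ih =>
      rw [hR] at hx1
      rw [map_inv, Equiv.Perm.inv_eq_iff_eq, hψ1, ih hx1]
      ext <;> simp
  have hstab : ∀ g ∈ MulAction.stabilizer G o, ψ g (1, o) = ((ψ g (1, o)).1, o) := by
    intro g hg
    exact Prod.ext rfl hg
  have : Finite (G ⧸ MulAction.stabilizer G o) :=
    .of_equiv _ (MulAction.orbitEquivQuotientStabilizer G o)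
  refine ⟨MulAction.stabilizer G o, fun x hx => ?_, Subgroup.finiteIndex_of_finite_quotient,
    MonoidHom.mk' (fun k => (ψ k (1, o)).1⁻¹) fun k l => ?_, fun h hh => ?_⟩
  · rw [MulAction.mem_stabilizer_iff, smul_def, hH x hx]
  · rw [Subgroup.coe_mul, map_mul, Equiv.Perm.mul_apply, hstab l l.2, hψ1, mul_inv_rev]
  · simp [hH h hh]

namespace RACG

variable {V : Type*} {Γ : SimpleGraph V}

section Action

variable (H : Subgroup (RACG Γ)) (P : Set (RACG Γ))

open Classical in
/-- Move across the wall of type `v` if this does not leave the cell. -/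
noncomputable def move (v : V) (f : cell P) : cell P :=
  if h : (f : RACG Γ) * racgGen Γ v ∈ cell P then ⟨f * racgGen Γ v, h⟩ else f

open Classical in
/-- The reflection, if it lies in `H`, by which the wall of type `v` leaves the cell. -/
noncomputable def holonomy (v : V) (f : cell P) : H :=
  if h : (f : RACG Γ) * racgGen Γ v ∉ cell P ∧ wall (f : RACG Γ) v ∈ H then ⟨wall f v, h.2⟩ else 1

variable {H P}

lemma move_of_mem {v : V} {f : cell P} (h : (f : RACG Γ) * racgGen Γ v ∈ cell P) :
    move P v f = ⟨f * racgGen Γ v, h⟩ := dif_pos h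

lemma move_of_notMem {v : V} {f : cell P} (h : (f : RACG Γ) * racgGen Γ v ∉ cell P) :
    move P v f = f := dif_neg h

lemma holonomy_of_mem {v : V} {f : cell P} (h : (f : RACG Γ) * racgGen Γ v ∈ cell P) :
    holonomy H P v f = 1 := dif_neg fun h' => h'.1 h

lemma move_move (v : V) (f : cell P) : move P v (move P v f) = f := by
  by_cases h : (f : RACG Γ) * racgGen Γ v ∈ cell P
  · have h1 : (f : RACG Γ) * racgGen Γ v * racgGen Γ v = f := by
      rw [mul_assoc, racgGen_mul_self, mul_one]
    rw [move_of_mem h, move_of_mem (by simp [h1])]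
    exact Subtype.ext h1
  · rw [move_of_notMem h, move_of_notMem h]

lemma holonomy_mul_holonomy (v : V) (f : cell P) :
    holonomy H P v f * holonomy H P v (move P v f) = 1 := by
  by_cases h : (f : RACG Γ) * racgGen Γ v ∈ cell P
  · have h1 : (f : RACG Γ) * racgGen Γ v * racgGen Γ v = f := by
      rw [mul_assoc, racgGen_mul_self, mul_one]
    rw [holonomy_of_mem h, move_of_mem h, holonomy_of_mem (by simp [h1]), one_mul]
  · rw [move_of_notMem h, holonomy]
    split_ifs
    · exact Subtype.ext (wall_mul_self _ v)
    · simp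

lemma mul_gen_move_mem_iff {u v : V} (h : racgGen Γ u * racgGen Γ v = racgGen Γ v * racgGen Γ u)
    (f : cell P) :
    (move P u f : RACG Γ) * racgGen Γ v ∈ cell P ↔ (f : RACG Γ) * racgGen Γ v ∈ cell P := by
  rw [mul_gen_mem_cell_iff (move P u f).2, mul_gen_mem_cell_iff f.2, move]
  split_ifs
  · rw [wall_mul_gen _ h]
  · rfl

lemma move_comm {u v : V} (h : racgGen Γ u * racgGen Γ v = racgGen Γ v * racgGen Γ u)
    (f : cell P) : move P u (move P v f) = move P v (move P u f) := by
  have h1 := mul_gen_move_mem_iff h f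
  have h2 := mul_gen_move_mem_iff h.symm f
  by_cases hu : (f : RACG Γ) * racgGen Γ u ∈ cell P <;>
  by_cases hv : (f : RACG Γ) * racgGen Γ v ∈ cell P
  · rw [move_of_mem (h1.2 hv), move_of_mem (h2.2 hu)]
    simp [move_of_mem hu, move_of_mem hv, mul_assoc, h]
  · rw [move_of_notMem (fun k => hv (h1.1 k)), move_of_notMem hv]
  · rw [move_of_notMem (fun k => hu (h2.1 k)), move_of_notMem hu]
  · rw [move_of_notMem hu, move_of_notMem hv, move_of_notMem hu]

lemma holonomy_move {u v : V} (h : racgGen Γ u * racgGen Γ v = racgGen Γ v * racgGen Γ u)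
    (f : cell P) : holonomy H P v (move P u f) = holonomy H P v f := by
  have hw : wall (move P u f : RACG Γ) v = wall (f : RACG Γ) v := by
    rw [move]
    split_ifs
    · exact wall_mul_gen _ h
    · rfl
  unfold holonomy
  have hm := mul_gen_move_mem_iff h f
  split_ifs with h1 h2 h2
  · exact Subtype.ext hw
  · exact absurd ⟨fun k => h1.1 (hm.2 k), hw ▸ h1.2⟩ h2
  · exact absurd ⟨fun k => h2.1 (hm.1 k), hw.symm ▸ h2.2⟩ h1
  · rfl

lemma holonomy_comm {u v : V} (h : racgGen Γ u * racgGen Γ v = racgGen Γ v * racgGen Γ u)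
    (f : cell P) :
    holonomy H P u f * holonomy H P v f = holonomy H P v f * holonomy H P u f := by
  simp only [holonomy]
  split_ifs
  · exact Subtype.ext (wall_comm _ h)
  all_goals simp

/-- The action on `H × cell P` obtained by gluing copies of the cell along its walls in `H`. -/
lemma exists_action (H : Subgroup (RACG Γ)) (P : Set (RACG Γ)) :
    ∃ ψ : RACG Γ →* Equiv.Perm (H × cell P), ∀ v p,
      ψ (racgGen Γ v) p = (p.1 * holonomy H P v p.2, move P v p.2) := by
  have inv : ∀ v, Function.Involutive
      fun p : H × cell P => (p.1 * holonomy H P v p.2, move P v p.2) := by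
    intro v p
    simp only [mul_assoc, holonomy_mul_holonomy, move_move, mul_one]
  obtain ⟨ψ, hψ⟩ := exists_lift (Γ := Γ) (fun v => (inv v).toPerm)
    (fun v => Equiv.ext (inv v)) (by
      intro u v h
      have hc := racgGen_comm h
      refine Equiv.ext fun p => ?_
      simp only [Equiv.Perm.mul_apply, Function.Involutive.coe_toPerm, mul_assoc,
        holonomy_move hc, holonomy_move hc.symm, holonomy_comm hc, move_comm hc])
  exact ⟨ψ, fun v p => by rw [hψ]; rfl⟩

end Action

end RACG

open RACG

theorem reflection_subgroup_virtual_retract {V : Type*} [Fintype V] (Γ : SimpleGraph V)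
    (S : Finset (RACG Γ)) (hS : ∀ x ∈ S, IsReflection Γ x) :
    ∃ K : Subgroup (RACG Γ), ∃ hK : Subgroup.closure (S : Set (RACG Γ)) ≤ K,
      K.FiniteIndex ∧
      ∃ r : K →* Subgroup.closure (S : Set (RACG Γ)),
        ∀ (h : RACG Γ) (hh : h ∈ Subgroup.closure (S : Set (RACG Γ))),
          (r ⟨h, hK hh⟩ : RACG Γ) = h := by
  set H := Subgroup.closure (S : Set (RACG Γ))
  obtain ⟨T, hTR, hTf, hST⟩ := Subgroup.exists_finite_subset_closure (G := RACG Γ)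
    (s := (S : Set (RACG Γ))) S.finite_toSet
    (R := {t : RACG Γ | t ∈ H ∧ ∃ f u, t = wall f u ∧
      Disjoint (inversions f) (H : Set (RACG Γ))}) (by
      intro x hx
      obtain ⟨g, v, hgv⟩ := hS x hx
      obtain ⟨l, rfl⟩ := wordProd_surjective g
      change x = wall (wordProd Γ l) v at hgv
      subst hgv
      exact wall_mem_closure H l v (Subgroup.subset_closure hx))
  have hTH : Subgroup.closure T = H :=
    le_antisymm ((Subgroup.closure_le _).2 fun t ht => (hTR ht).1) ((Subgroup.closure_le _).2 hST)
  have hR : ∀ t ∈ T, ∃ f : RACG Γ, (∃ u, t = wall f u) ∧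
      Disjoint (inversions f) (H : Set (RACG Γ)) := by
    intro t ht
    obtain ⟨-, f, u, hu, hd⟩ := hTR ht
    exact ⟨f, ⟨u, hu⟩, hd⟩
  choose! f hfu hdisj using hR
  set P : Set (RACG Γ) := ⋃ t ∈ T, inversions (f t)
  have hPf : P.Finite := hTf.biUnion fun t _ => inversions_finite _
  have hPH : Disjoint P (H : Set (RACG Γ)) := Set.disjoint_iUnion₂_left.2 hdisj
  have : Finite (cell P) := cell_finite hPf
  obtain ⟨ψ, hψ⟩ := exists_action H P
  have hequiv : ∀ g a p, ψ g (a * p.1, p.2) = (a * (ψ g p).1, (ψ g p).2) := by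
    intro g a p
    obtain ⟨l, rfl⟩ := wordProd_surjective g
    induction l with
    | nil => simp [wordProd]
    | cons v l ih =>
      rw [wordProd_cons, map_mul, Equiv.Perm.mul_apply, Equiv.Perm.mul_apply, ih, hψ, hψ]
      simp [mul_assoc]
  have hpath : ∀ l, IsGeodesic Γ l → ∀ hl : wordProd Γ l ∈ cell P,
      ψ (wordProd Γ l) (1, ⟨wordProd Γ l, hl⟩) = (1, ⟨1, one_mem_cell P⟩) := by
    intro l
    induction l using List.reverseRecOn with
    | nil =>
      intro _ _
      simp [wordProd]
    | append_singleton l v ih =>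
      intro hg hl
      have hl' : wordProd Γ l ∈ cell P := by
        refine Set.Subset.trans ?_ hl
        rw [hg.inversions_concat]
        exact Set.subset_insert _ _
      have hback : wordProd Γ (l ++ [v]) * racgGen Γ v = wordProd Γ l := by
        rw [wordProd_concat, mul_assoc, racgGen_mul_self, mul_one]
      have hm : wordProd Γ (l ++ [v]) * racgGen Γ v ∈ cell P := hback ▸ hl'
      have hmul : ψ (wordProd Γ (l ++ [v])) = ψ (wordProd Γ l) * ψ (racgGen Γ v) := by
        rw [wordProd_concat, map_mul]
      rw [hmul, Equiv.Perm.mul_apply, hψ, holonomy_of_mem hm, move_of_mem hm]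
      simpa [hback] using ih hg.of_concat hl'
  refine Subgroup.virtual_retract_of_perm H ψ hequiv ⟨1, one_mem_cell P⟩ T hTH fun t ht htT => ?_
  have hft : f t ∈ cell P := Set.subset_biUnion_of_mem (u := fun t => inversions (f t)) htT
  obtain ⟨l, hl, hlf⟩ := exists_isGeodesic (f t)
  have hbase : ψ (f t) (1, ⟨f t, hft⟩) = (1, ⟨1, one_mem_cell P⟩) := by
    have := hpath l hl (hlf ▸ hft)
    simpa only [hlf] using this
  obtain ⟨u, hu⟩ := hfu t htT
  have hwall : wall (f t) u = t := hu.symm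
  have hout : f t * racgGen Γ u ∉ cell P := by
    rw [mul_gen_mem_cell_iff hft, hwall]
    exact fun h => Set.disjoint_left.1 hPH h ht
  have hhol : holonomy H P u ⟨f t, hft⟩ = ⟨t, ht⟩ := by
    rw [holonomy, dif_pos ⟨hout, hwall.symm ▸ ht⟩]
    exact Subtype.ext hwall
  have hsq : t * t = 1 := hwall ▸ wall_mul_self (f t) u
  have htinv : (⟨t, ht⟩ : H)⁻¹ = ⟨t, ht⟩ := inv_eq_of_mul_eq_one_left (Subtype.ext hsq)
  have hψt : ψ t = ψ (f t) * ψ (racgGen Γ u) * (ψ (f t))⁻¹ := by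
    rw [← map_inv, ← map_mul, ← map_mul, ← wall, hwall]
  have hinv : (ψ (f t))⁻¹ (1, ⟨1, one_mem_cell P⟩) = (1, ⟨f t, hft⟩) := by
    rw [Equiv.Perm.inv_eq_iff_eq, hbase]
  have htrans := hequiv (f t) ⟨t, ht⟩ (1, ⟨f t, hft⟩)
  rw [hψt, Equiv.Perm.mul_apply, Equiv.Perm.mul_apply, hinv, hψ, hhol, move_of_notMem hout, one_mul,
    htinv]
  simpa [hbase] using htrans
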